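/- arXiv:2010.01221 — 2 statements merged into one kernel-verified Lean document; each statement's English description precedes it below -/
import Mathlib

section
/- Let μ be a doubling measure on ℝⁿ and let w ∈ L¹_loc(ℝⁿ, dμ) be a weight (w ≥ 0, with 0 < ∫_Q w dμ < ∞ for every cube Q). Suppose there are a constant C > 0 and an increasing bijection Φ : [0,1] → [0,1] such that for every cube Q and every countable pairwise-disjoint family {Q_j}_{j∈ℕ} of subcubes of Q: w(⋃_j Q_j)/w(Q) ≤ C Φ⁻¹(μ(⋃_j Q_j)/μ(Q)), where w(E) := ∫_E w dμ. Then w ∈ A_∞(dμ), i.e. there exist δ, C' > 0 such that w(E)/w(Q) ≤ C' (μ(E)/μ(Q))^δ for every cube Q and every measurable subset E ⊆ Q. -/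
open MeasureTheory Set Filter
open scoped ENNReal

noncomputable section

/-- An axis-parallel cube in `ℝⁿ`, given by its lower corner and (positive) sidelength. -/
structure Cube (n : ℕ) where
  corner : Fin n → ℝ
  side : ℝ
  side_pos : 0 < side

/-- The set of points of a cube. -/
def Cube.carrier {n : ℕ} (Q : Cube n) : Set (Fin n → ℝ) :=
  {x | ∀ i, Q.corner i ≤ x i ∧ x i ≤ Q.corner i + Q.side}

/-- A Borel measure on `ℝⁿ` is doubling with doubling constant `c ≥ 1` and doubling
dimension `d > 0`: every cube has finite positive measure and
`μ(Q̃) ≤ c (ℓ(Q̃)/ℓ(Q))^d μ(Q)` whenever `Q ⊆ Q̃`. -/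
def IsDoubling {n : ℕ} (μ : Measure (Fin n → ℝ)) (c d : ℝ) : Prop :=
  1 ≤ c ∧ 0 < d ∧ (∀ Q : Cube n, 0 < μ Q.carrier ∧ μ Q.carrier < ⊤) ∧
    ∀ Q Q' : Cube n, Q.carrier ⊆ Q'.carrier →
      μ Q'.carrier ≤ ENNReal.ofReal (c * (Q'.side / Q.side) ^ d) * μ Q.carrier

/-- `f_{Q,μ}`, the `μ`-average of `f` over the cube `Q`. -/
def cubeAvg {n : ℕ} (μ : Measure (Fin n → ℝ)) (Q : Cube n) (f : (Fin n → ℝ) → ℝ) : ℝ :=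
  ⨍ x in Q.carrier, f x ∂μ

/-- The mean oscillation of `f` over the cube `Q`. -/
def osc {n : ℕ} (μ : Measure (Fin n → ℝ)) (Q : Cube n) (f : (Fin n → ℝ) → ℝ) : ℝ :=
  ⨍ x in Q.carrier, |f x - cubeAvg μ Q f| ∂μ

/-- The `BMO(dμ)` norm: supremum of the mean oscillations over all cubes. -/
def bmoNorm {n : ℕ} (μ : Measure (Fin n → ℝ)) (f : (Fin n → ℝ) → ℝ) : ℝ :=
  ⨆ Q : Cube n, osc μ Q f

/-- Membership in `BMO(dμ)`: local integrability together with a finite supremum of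
mean oscillations. -/
def MemBMO {n : ℕ} (μ : Measure (Fin n → ℝ)) (f : (Fin n → ℝ) → ℝ) : Prop :=
  LocallyIntegrable f μ ∧ BddAbove (Set.range fun Q : Cube n => osc μ Q f)

/-- The local Luxemburg norm `‖f‖_{φ(L)(Q, dν/ν(Q))}`. -/
def luxNorm {n : ℕ} (φ : ℝ → ℝ) (ν : Measure (Fin n → ℝ)) (Q : Cube n)
    (f : (Fin n → ℝ) → ℝ) : ℝ :=
  sInf {l : ℝ | 0 < l ∧
    ∫⁻ x in Q.carrier, ENNReal.ofReal (φ (|f x| / l)) ∂ν ≤ ν Q.carrier}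

/-- The local variable-exponent Luxemburg norm `‖f‖_{L^{p(·)}(Q, dx/|Q|)}`. -/
def vpLuxNorm {n : ℕ} (p : (Fin n → ℝ) → ℝ) (Q : Cube n) (f : (Fin n → ℝ) → ℝ) : ℝ :=
  sInf {l : ℝ | 0 < l ∧
    ∫⁻ x in Q.carrier, ENNReal.ofReal ((|f x| / l) ^ p x) ≤ volume Q.carrier}

namespace Cube

variable {n : ℕ}

/-- The cube of sidelength `2 * r` centred at `x`. -/
def centered (x : Fin n → ℝ) (r : ℝ) (hr : 0 < r) : Cube n :=
  ⟨fun i => x i - r, 2 * r, by positivity⟩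

lemma carrier_centered (x : Fin n → ℝ) (r : ℝ) (hr : 0 < r) :
    (centered x r hr).carrier = Metric.closedBall x r := by
  ext y
  simp only [carrier, centered, mem_ofPred_eq, Metric.mem_closedBall, dist_pi_le_iff hr.le,
    Real.dist_eq, abs_le]
  refine forall_congr' fun i => ⟨fun h => ⟨?_, ?_⟩, fun h => ⟨?_, ?_⟩⟩ <;> linarith [h.1, h.2]

/-- The centre of a cube. -/
def center (Q : Cube n) : Fin n → ℝ := fun i => Q.corner i + Q.side / 2

lemma carrier_eq_closedBall (Q : Cube n) :
    Q.carrier = Metric.closedBall Q.center (Q.side / 2) := by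
  rw [← carrier_centered _ _ (half_pos Q.side_pos)]
  ext y
  simp only [carrier, centered, center, mem_ofPred_eq]
  refine forall_congr' fun i => ⟨fun h => ⟨?_, ?_⟩, fun h => ⟨?_, ?_⟩⟩ <;> linarith [h.1, h.2]

lemma isClosed_carrier (Q : Cube n) : IsClosed Q.carrier := by
  rw [carrier_eq_closedBall]
  exact Metric.isClosed_closedBall

lemma isCompact_carrier (Q : Cube n) : IsCompact Q.carrier := by
  rw [carrier_eq_closedBall]
  exact isCompact_closedBall _ _

lemma measurableSet_carrier (Q : Cube n) : MeasurableSet Q.carrier :=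
  Q.isClosed_carrier.measurableSet

lemma interior_carrier_nonempty (Q : Cube n) : (interior Q.carrier).Nonempty := by
  rw [carrier_eq_closedBall]
  exact ((Metric.nonempty_ball.2 (half_pos Q.side_pos)).mono
    Metric.ball_subset_interior_closedBall)

lemma carrier_subset_closedBall {Q : Cube n} {x : Fin n → ℝ} (hx : x ∈ Q.carrier) :
    Q.carrier ⊆ Metric.closedBall x Q.side := by
  intro y hy
  rw [Metric.mem_closedBall, dist_pi_le_iff Q.side_pos.le]
  intro i
  rw [Real.dist_eq, abs_le]
  constructor <;> linarith [(hx i).1, (hx i).2, (hy i).1, (hy i).2]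

/-- Every point of a cube lies in a subcube of any prescribed smaller sidelength. -/
lemma exists_subcube {Q : Cube n} {x : Fin n → ℝ} (hx : x ∈ Q.carrier) {r : ℝ} (hr : 0 < r)
    (hrQ : r ≤ Q.side) : ∃ P : Cube n, P.side = r ∧ x ∈ P.carrier ∧ P.carrier ⊆ Q.carrier := by
  refine ⟨⟨fun i => min (x i) (Q.corner i + Q.side - r), r, hr⟩, rfl, fun i => ⟨?_, ?_⟩,
    fun y hy i => ⟨?_, ?_⟩⟩
  · exact min_le_left _ _
  · dsimp only
    rcases min_choice (x i) (Q.corner i + Q.side - r) with h | h <;> rw [h] <;>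
      linarith [(hx i).2]
  · refine le_trans (le_min (hx i).1 ?_) (hy i).1
    linarith
  · have h1 := (hy i).2
    have h2 := min_le_right (x i) (Q.corner i + Q.side - r)
    dsimp only at h1
    linarith

/-- The part of a ball centred in a cube that lies in the cube is covered by `2 ^ n` cubes of
sidelength the radius. -/
lemma exists_cover_closedBall_inter {Q : Cube n} {x : Fin n → ℝ} (hx : x ∈ Q.carrier) {r : ℝ}
    (hr : 0 < r) (hrQ : r ≤ Q.side) :
    ∃ P : (Fin n → Bool) → Cube n,
      (∀ s, (P s).side = r ∧ (P s).carrier ⊆ Metric.closedBall x r ∩ Q.carrier) ∧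
      Metric.closedBall x r ∩ Q.carrier ⊆ ⋃ s, (P s).carrier := by
  set a : Fin n → ℝ := fun i => max (x i - r) (Q.corner i) with ha
  set b : Fin n → ℝ := fun i => min (x i + r) (Q.corner i + Q.side) with hb
  have hab : ∀ i, a i + r ≤ b i := fun i => by
    simp only [ha, hb]
    rcases max_choice (x i - r) (Q.corner i) with h | h <;>
    rcases min_choice (x i + r) (Q.corner i + Q.side) with h' | h' <;> rw [h, h'] <;>
    linarith [(hx i).1, (hx i).2]
  have hba : ∀ i, b i ≤ a i + 2 * r := fun i => by
    have := le_max_left (x i - r) (Q.corner i)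
    have := min_le_left (x i + r) (Q.corner i + Q.side)
    simp only [ha, hb]
    linarith
  have hmem : ∀ y, y ∈ Metric.closedBall x r ∩ Q.carrier ↔ ∀ i, a i ≤ y i ∧ y i ≤ b i := by
    intro y
    simp only [mem_inter_iff, Metric.mem_closedBall, dist_pi_le_iff hr.le, Real.dist_eq, abs_le,
      carrier, mem_ofPred_eq, ha, hb, max_le_iff, le_min_iff]
    rw [← forall_and]
    refine forall_congr' fun i => ⟨fun h => ⟨⟨?_, ?_⟩, ?_, ?_⟩, fun h => ⟨⟨?_, ?_⟩, ?_, ?_⟩⟩ <;>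
      linarith [h.1.1, h.1.2, h.2.1, h.2.2]
  refine ⟨fun s => ⟨fun i => if s i then a i else b i - r, r, hr⟩, fun s => ⟨rfl, ?_⟩, ?_⟩
  · intro y hy
    rw [hmem]
    intro i
    have h := hy i
    dsimp only at h
    split_ifs at h <;> constructor <;> linarith [h.1, h.2, hab i]
  · intro y hy
    rw [hmem] at hy
    refine mem_iUnion.2 ⟨fun i => decide (y i ≤ a i + r), fun i => ?_⟩
    dsimp only
    by_cases h : y i ≤ a i + r
    · simp only [h, decide_true, if_true]
      exact ⟨(hy i).1, trivial⟩
    · simp only [h, decide_false, Bool.false_eq_true, if_false]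
      constructor <;> linarith [hba i, (hy i).2]

end Cube

section Doubling

variable {n : ℕ} {μ : Measure (Fin n → ℝ)} {c d : ℝ}

lemma IsDoubling.isLocallyFiniteMeasure (hμ : IsDoubling μ c d) : IsLocallyFiniteMeasure μ := by
  refine ⟨fun x => ⟨Metric.closedBall x 1, Metric.closedBall_mem_nhds x one_pos, ?_⟩⟩
  rw [← Cube.carrier_centered x 1 one_pos]
  exact (hμ.2.2.1 _).2

lemma IsDoubling.measure_le_of_side (hμ : IsDoubling μ c d) {P Q : Cube n} {k : ℝ}
    (hPQ : P.carrier ⊆ Q.carrier) (hk : Q.side = k * P.side) :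
    μ Q.carrier ≤ ENNReal.ofReal (c * k ^ d) * μ P.carrier := by
  have := hμ.2.2.2 P Q hPQ
  rwa [hk, mul_div_cancel_right₀ _ P.side_pos.ne'] at this

end Doubling

open scoped Topology NNReal

section Smallness

variable {n : ℕ} {μ ν : Measure (Fin n → ℝ)} {c d : ℝ}

/-- Up to a null set, a subset of a cube that is contained in an open set is covered by countably
many disjoint subcubes lying in that open set. -/
lemma IsDoubling.exists_disjoint_subcubes (hμ : IsDoubling μ c d) (Q : Cube n)
    {E G : Set (Fin n → ℝ)} (hEQ : E ⊆ Q.carrier) (hEG : E ⊆ G) (hG : IsOpen G) :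
    ∃ (J : Set ℕ) (Qj : ℕ → Cube n), (∀ j ∈ J, (Qj j).carrier ⊆ Q.carrier ∩ G) ∧
      (J.Pairwise fun i j => Disjoint (Qj i).carrier (Qj j).carrier) ∧
      μ (E \ ⋃ j ∈ J, (Qj j).carrier) = 0 := by
  have := hμ.isLocallyFiniteMeasure
  obtain ⟨u, hut, hu, hdisj, hcov⟩ := Vitali.exists_disjoint_covering_ae μ E
    {a : (Fin n → ℝ) × Cube n | a.1 ∈ a.2.carrier ∧ a.2.carrier ⊆ Q.carrier ∩ G}
    (c * 6 ^ d).toNNReal (fun a => a.2.side) (fun a => a.1) (fun a => a.2.carrier)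
    (fun a ha => Cube.carrier_subset_closedBall ha.1)
    (fun a ha => by
      have h3 : 0 < 3 * a.2.side := mul_pos three_pos a.2.side_pos
      rw [← Cube.carrier_centered a.1 _ h3]
      refine hμ.measure_le_of_side (k := 6) ?_ ?_
      · rw [Cube.carrier_centered]
        exact (Cube.carrier_subset_closedBall ha.1).trans
          (Metric.closedBall_subset_closedBall (by linarith))
      · simp only [Cube.centered]
        ring)
    (fun a _ => a.2.interior_carrier_nonempty) (fun a _ => a.2.isClosed_carrier)
    (fun x hx ε hε => by
      obtain ⟨r, hr, hrG⟩ := Metric.isOpen_iff.1 hG x (hEG hx)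
      have hs : 0 < min (min ε Q.side) (r / 2) :=
        lt_min (lt_min hε Q.side_pos) (half_pos hr)
      obtain ⟨P, hPs, hxP, hPQ⟩ := Cube.exists_subcube (hEQ hx) hs
        ((min_le_left _ _).trans (min_le_right _ _))
      refine ⟨(x, P), ⟨hxP, subset_inter hPQ ?_⟩, ?_, rfl⟩
      · refine (Cube.carrier_subset_closedBall hxP).trans
          ((Metric.closedBall_subset_ball ?_).trans hrG)
        rw [hPs]
        exact (min_le_right _ _).trans_lt (half_lt_self hr)
      · exact hPs.le.trans ((min_le_left _ _).trans (min_le_left _ _)))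
  have := hu.to_subtype
  obtain ⟨f, hf⟩ := exists_injective_nat u
  have hext : ∀ a : u, Function.extend f (fun a : u => a.1.2) (fun _ => Q) (f a) = a.1.2 :=
    fun a => hf.extend_apply _ _ a
  refine ⟨range f, Function.extend f (fun a : u => a.1.2) (fun _ => Q), ?_, ?_, ?_⟩
  · rintro _ ⟨a, rfl⟩
    rw [hext]
    exact (hut a.2).2
  · rintro _ ⟨a, rfl⟩ _ ⟨b, rfl⟩ hab
    rw [hext, hext]
    exact hdisj a.2 b.2 fun h => hab (congrArg f (Subtype.ext h))
  · rw [biUnion_range]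
    simp only [hext]
    rwa [biUnion_eq_iUnion] at hcov

/-- Smallness of `ν` relative to `μ` on countable disjoint unions of subcubes passes to all
measurable subsets of cubes. -/
lemma IsDoubling.small_of_small_iUnion (hμ : IsDoubling μ c d) (hνμ : ν ≪ μ) {ε θ : ℝ≥0∞}
    (h : ∀ (Q : Cube n) (J : Set ℕ) (Qj : ℕ → Cube n),
      (∀ j ∈ J, (Qj j).carrier ⊆ Q.carrier) →
      (J.Pairwise fun i j => Disjoint (Qj i).carrier (Qj j).carrier) →
      μ (⋃ j ∈ J, (Qj j).carrier) ≤ ε * μ Q.carrier →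
      ν (⋃ j ∈ J, (Qj j).carrier) ≤ θ * ν Q.carrier)
    (Q : Cube n) {E : Set (Fin n → ℝ)} (hEQ : E ⊆ Q.carrier)
    (hE : μ E < ε * μ Q.carrier) : ν E ≤ θ * ν Q.carrier := by
  have := hμ.isLocallyFiniteMeasure
  obtain ⟨G, hEG, hG, hGμ⟩ := E.exists_isOpen_lt_of_lt _ hE
  obtain ⟨J, Qj, hsub, hdisj, hcov⟩ := hμ.exists_disjoint_subcubes Q hEQ hEG hG
  calc ν E ≤ ν (⋃ j ∈ J, (Qj j).carrier) := measure_mono_ae (ae_le_set.2 (hνμ hcov))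
    _ ≤ θ * ν Q.carrier := h Q J Qj (fun j hj => (hsub j hj).trans inter_subset_left) hdisj
        ((measure_mono (iUnion₂_subset fun j hj => (hsub j hj).trans inter_subset_right)).trans
          hGμ.le)

/-- If `ν (E ∩ P)` is small relative to `ν P` for the subcubes `P` of sidelength `r` of a ball of
radius `r` centred in `Q`, then the same holds for the part of the ball lying in `Q`. -/
lemma measure_closedBall_inter_le {Q : Cube n} {x : Fin n → ℝ} (hx : x ∈ Q.carrier) {r : ℝ}
    (hr : 0 < r) (hrQ : r ≤ Q.side) {E : Set (Fin n → ℝ)} {θ : ℝ≥0∞} (hEQ : E ⊆ Q.carrier)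
    (h : ∀ P : Cube n, P.side = r → P.carrier ⊆ Metric.closedBall x r →
      P.carrier ⊆ Q.carrier → ν (E ∩ P.carrier) ≤ θ * ν P.carrier) :
    ν (E ∩ Metric.closedBall x r) ≤ 2 ^ n * θ * ν (Metric.closedBall x r ∩ Q.carrier) := by
  obtain ⟨P, hP, hcov⟩ := Cube.exists_cover_closedBall_inter hx hr hrQ
  calc ν (E ∩ Metric.closedBall x r) ≤ ν (⋃ s, E ∩ (P s).carrier) := by
        refine measure_mono fun y hy => ?_
        rw [← inter_iUnion]
        exact ⟨hy.1, hcov ⟨hy.2, hEQ hy.1⟩⟩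
    _ ≤ ∑ s, ν (E ∩ (P s).carrier) := measure_iUnion_fintype_le _ _
    _ ≤ ∑ _s : Fin n → Bool, θ * ν (Metric.closedBall x r ∩ Q.carrier) := by
        refine Finset.sum_le_sum fun s _ => ?_
        refine (h (P s) (hP s).1 ((hP s).2.trans inter_subset_left)
          ((hP s).2.trans inter_subset_right)).trans ?_
        gcongr
        exact (hP s).2
    _ = 2 ^ n * θ * ν (Metric.closedBall x r ∩ Q.carrier) := by
        simp [mul_assoc]

/-- At almost every point of a set `E` of small relative measure in `Q` there is a scale at which
the density of `E` first exceeds `ε`. -/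
lemma IsDoubling.ae_exists_stopping_radius (hμ : IsDoubling μ c d) (Q : Cube n)
    {E : Set (Fin n → ℝ)} (hEm : MeasurableSet E) (hEQ : E ⊆ Q.carrier) {ε : ℝ≥0∞} (hε : ε < 1)
    (hE : μ E ≤ ε * μ Q.carrier) :
    ∀ᵐ x ∂μ.restrict E, ∃ r : ℝ, 0 < r ∧ r ≤ Q.side ∧
      ε * μ (Metric.closedBall x r) ≤ μ (E ∩ Metric.closedBall x r) ∧
      μ (E ∩ Metric.closedBall x (2 * r)) ≤ ε * μ (Metric.closedBall x (2 * r)) := by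
  have := hμ.isLocallyFiniteMeasure
  filter_upwards [Besicovitch.ae_tendsto_measure_inter_div μ E, ae_restrict_mem hEm] with x hx hxE
  set R : ℕ → ℝ := fun k => Q.side * (1 / 2) ^ k with hR
  have hRpos : ∀ k, 0 < R k := fun k => mul_pos Q.side_pos (by positivity)
  have hlim : Tendsto R atTop (𝓝[>] 0) := by
    refine tendsto_nhdsWithin_iff.2 ⟨?_, Eventually.of_forall hRpos⟩
    simpa [hR] using (tendsto_pow_atTop_nhds_zero_of_lt_one (r := (1 / 2 : ℝ)) (by norm_num)
      (by norm_num)).const_mul Q.side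
  have hex : ∃ k, ε * μ (Metric.closedBall x (R k)) < μ (E ∩ Metric.closedBall x (R k)) := by
    obtain ⟨k, hk⟩ := ((hx.comp hlim).eventually (lt_mem_nhds hε)).exists
    refine ⟨k, ?_⟩
    have hpos := hμ.2.2.1 (Cube.centered x (R k) (hRpos k))
    rw [Cube.carrier_centered] at hpos
    exact (ENNReal.lt_div_iff_mul_lt (Or.inl hpos.1.ne') (Or.inl hpos.2.ne)).1 hk
  classical
  have hspec := Nat.find_spec hex
  have hmin := fun m hm => Nat.find_min hex (m := m) hm
  rcases hk : Nat.find hex with _ | k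
  · rw [hk] at hspec
    refine absurd hspec (not_lt.2 ?_)
    refine (measure_mono inter_subset_left).trans (hE.trans ?_)
    gcongr
    simpa [hR] using Cube.carrier_subset_closedBall (hEQ hxE)
  · rw [hk] at hspec hmin
    have h2 : 2 * R (k + 1) = R k := by
      simp only [hR, pow_succ]
      ring
    refine ⟨R (k + 1), hRpos _, ?_, hspec.le, ?_⟩
    · exact mul_le_of_le_one_right Q.side_pos.le (pow_le_one₀ (by norm_num) (by norm_num))
    · rw [h2]
      exact not_lt.1 (hmin k k.lt_succ_self)

end Smallness

section Covering

variable {n : ℕ} {μ ν : Measure (Fin n → ℝ)} {c d : ℝ}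

/-- Besicovitch covering by stopping balls: a set `E` of small relative measure in `Q` is dominated
by a set `F` of comparable `μ`-measure, relative to which `E` has small `ν`-measure. -/
lemma IsDoubling.exists_enlargement (hμ : IsDoubling μ c d) (hνμ : ν ≪ μ) {N : ℕ} {τ : ℝ}
    (hτ : 1 < τ) (hN : IsEmpty (Besicovitch.SatelliteConfig (Fin n → ℝ) N τ)) {ε₀ ε θ : ℝ≥0∞}
    (h : ∀ (Q : Cube n) (E : Set (Fin n → ℝ)), E ⊆ Q.carrier → μ E < ε₀ * μ Q.carrier →
      ν E ≤ θ * ν Q.carrier)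
    (hε₀ : ε * ENNReal.ofReal (c * 4 ^ d) < ε₀) (hε : ε < 1) (Q : Cube n)
    {E : Set (Fin n → ℝ)} (hEm : MeasurableSet E) (hEQ : E ⊆ Q.carrier)
    (hE : μ E ≤ ε * μ Q.carrier) :
    ∃ F, MeasurableSet F ∧ F ⊆ Q.carrier ∧ ε * μ F ≤ N * μ E ∧
      ν E ≤ N * (2 ^ n * θ) * ν F := by
  have hae := hμ.ae_exists_stopping_radius Q hEm hEQ hε hE
  rw [ae_restrict_iff' hEm, ae_iff] at hae
  set A : Set (Fin n → ℝ) := {x | x ∈ E ∧ ∃ r : ℝ, 0 < r ∧ r ≤ Q.side ∧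
      ε * μ (Metric.closedBall x r) ≤ μ (E ∩ Metric.closedBall x r) ∧
      μ (E ∩ Metric.closedBall x (2 * r)) ≤ ε * μ (Metric.closedBall x (2 * r))}
  have hEA : μ (E \ A) = 0 := by
    refine measure_mono_null (fun x hx => ?_) hae
    exact fun hx' => hx.2 ⟨hx.1, hx' hx.1⟩
  choose r hr0 hrQ hlow hup using fun x : A => x.2.2
  have hball : ∀ x : A, ν (E ∩ Metric.closedBall x (r x)) ≤
      2 ^ n * θ * ν (Metric.closedBall x (r x) ∩ Q.carrier) := by
    intro x
    refine measure_closedBall_inter_le (hEQ x.2.1) (hr0 x) (hrQ x) hEQ fun P hPr hPB hPQ => ?_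
    refine h P _ inter_subset_right ?_
    have h2 : 0 < 2 * r x := mul_pos two_pos (hr0 x)
    have hPB2 : P.carrier ⊆ Metric.closedBall (x : Fin n → ℝ) (2 * r x) :=
      hPB.trans (Metric.closedBall_subset_closedBall (by linarith [hr0 x]))
    have hdoub : μ (Metric.closedBall (x : Fin n → ℝ) (2 * r x)) ≤
        ENNReal.ofReal (c * 4 ^ d) * μ P.carrier := by
      rw [← Cube.carrier_centered _ _ h2] at hPB2 ⊢
      refine hμ.measure_le_of_side hPB2 ?_
      rw [hPr, Cube.centered]
      ring
    calc μ (E ∩ P.carrier) ≤ μ (E ∩ Metric.closedBall (x : Fin n → ℝ) (2 * r x)) := by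
          gcongr
      _ ≤ ε * (ENNReal.ofReal (c * 4 ^ d) * μ P.carrier) := (hup x).trans (by gcongr)
      _ = ε * ENNReal.ofReal (c * 4 ^ d) * μ P.carrier := (mul_assoc _ _ _).symm
      _ < ε₀ * μ P.carrier :=
        (ENNReal.mul_lt_mul_iff_left (hμ.2.2.1 P).1.ne' (hμ.2.2.1 P).2.ne).2 hε₀
  obtain ⟨s, hsdisj, hscov⟩ := Besicovitch.exist_disjoint_covering_families hτ hN
    (⟨fun x : A => (x : Fin n → ℝ), r, hr0, Q.side, hrQ⟩ : Besicovitch.BallPackage A (Fin n → ℝ))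
  dsimp only at hsdisj hscov
  have hscount : ∀ i, (s i).Countable := fun i =>
    (hsdisj i).countable_of_nonempty_interior fun x _ =>
      (Metric.nonempty_ball.2 (hr0 x)).mono Metric.ball_subset_interior_closedBall
  set U : Fin N → Set (Fin n → ℝ) := fun i => ⋃ x ∈ s i, Metric.closedBall (x : Fin n → ℝ) (r x)
    with hU
  have hUm : ∀ i, MeasurableSet (U i) := fun i =>
    MeasurableSet.biUnion (hscount i) fun x _ => Metric.isClosed_closedBall.measurableSet
  have hUμ : ∀ i, ε * μ (U i) ≤ μ E := by
    intro i
    calc ε * μ (U i) ≤ ε * ∑' x : s i, μ (Metric.closedBall (x : Fin n → ℝ) (r x)) := by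
          gcongr
          exact measure_biUnion_le μ (hscount i) _
      _ = ∑' x : s i, ε * μ (Metric.closedBall (x : Fin n → ℝ) (r x)) := ENNReal.tsum_mul_left.symm
      _ ≤ ∑' x : s i, μ (E ∩ Metric.closedBall (x : Fin n → ℝ) (r x)) :=
          ENNReal.tsum_le_tsum fun x => hlow x
      _ = μ (⋃ x ∈ s i, E ∩ Metric.closedBall (x : Fin n → ℝ) (r x)) :=
          (measure_biUnion (hscount i)
            ((hsdisj i).mono fun _ => inter_subset_right)
            fun x _ => hEm.inter Metric.isClosed_closedBall.measurableSet).symm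
      _ ≤ μ E := measure_mono (iUnion₂_subset fun _ _ => inter_subset_left)
  have hUν : ∀ i, ν (E ∩ U i) ≤ 2 ^ n * θ * ν (U i ∩ Q.carrier) := by
    intro i
    calc ν (E ∩ U i) = ν (⋃ x ∈ s i, E ∩ Metric.closedBall (x : Fin n → ℝ) (r x)) := by
          rw [hU, inter_iUnion₂]
      _ ≤ ∑' x : s i, ν (E ∩ Metric.closedBall (x : Fin n → ℝ) (r x)) :=
          measure_biUnion_le ν (hscount i) _
      _ ≤ ∑' x : s i, 2 ^ n * θ * ν (Metric.closedBall (x : Fin n → ℝ) (r x) ∩ Q.carrier) :=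
          ENNReal.tsum_le_tsum fun x => hball x
      _ = 2 ^ n * θ * ν (⋃ x ∈ s i, Metric.closedBall (x : Fin n → ℝ) (r x) ∩ Q.carrier) := by
          rw [ENNReal.tsum_mul_left, measure_biUnion (hscount i)
            ((hsdisj i).mono fun _ => inter_subset_left)
            fun x _ => Metric.isClosed_closedBall.measurableSet.inter Q.measurableSet_carrier]
      _ = 2 ^ n * θ * ν (U i ∩ Q.carrier) := by rw [hU, iUnion₂_inter]
  have hAU : A ⊆ ⋃ i, U i := by
    refine fun x hx => ?_
    have := hscov (mem_range_self (⟨x, hx⟩ : A))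
    simp only [mem_iUnion, hU] at this ⊢
    obtain ⟨i, y, hy, hxy⟩ := this
    exact ⟨i, y, hy, Metric.ball_subset_closedBall hxy⟩
  refine ⟨(⋃ i, U i) ∩ Q.carrier, (MeasurableSet.iUnion hUm).inter Q.measurableSet_carrier,
    inter_subset_right, ?_, ?_⟩
  · calc ε * μ ((⋃ i, U i) ∩ Q.carrier) ≤ ε * ∑ i, μ (U i) := by
          gcongr
          exact (measure_mono inter_subset_left).trans (measure_iUnion_fintype_le _ _)
      _ = ∑ i, ε * μ (U i) := Finset.mul_sum _ _ _
      _ ≤ ∑ _i : Fin N, μ E := Finset.sum_le_sum fun i _ => hUμ i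
      _ = N * μ E := by simp
  · calc ν E ≤ ν (⋃ i, E ∩ U i) := by
          refine measure_mono_ae (ae_le_set.2 (hνμ (measure_mono_null (fun x hx => ?_) hEA)))
          refine ⟨hx.1, fun hxA => hx.2 ?_⟩
          rw [← inter_iUnion]
          exact ⟨hx.1, hAU hxA⟩
      _ ≤ ∑ i, ν (E ∩ U i) := measure_iUnion_fintype_le _ _
      _ ≤ ∑ _i : Fin N, 2 ^ n * θ * ν ((⋃ i, U i) ∩ Q.carrier) := by
          refine Finset.sum_le_sum fun i _ => (hUν i).trans ?_
          gcongr
          exact subset_iUnion U i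
      _ = N * (2 ^ n * θ) * ν ((⋃ i, U i) ∩ Q.carrier) := by simp [mul_assoc]

/-- If `ν` is arbitrarily small relative to `μ` on sets of small relative `μ`-measure in cubes,
then it decays geometrically along a geometric scale of relative `μ`-measures. -/
lemma IsDoubling.exists_geometric_decay (hμ : IsDoubling μ c d) (hνμ : ν ≪ μ)
    (h : ∀ θ : ℝ≥0∞, θ ≠ 0 → ∃ ε₀ : ℝ≥0∞, ε₀ ≠ 0 ∧ ∀ (Q : Cube n) (E : Set (Fin n → ℝ)),
      E ⊆ Q.carrier → μ E < ε₀ * μ Q.carrier → ν E ≤ θ * ν Q.carrier) :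
    ∃ a : ℝ, 0 < a ∧ a < 1 ∧ ∀ (k : ℕ) (Q : Cube n) (E : Set (Fin n → ℝ)), MeasurableSet E →
      E ⊆ Q.carrier → μ E ≤ ENNReal.ofReal a ^ k * μ Q.carrier → ν E ≤ 2⁻¹ ^ k * ν Q.carrier := by
  obtain ⟨N, τ, hτ, hN⟩ := HasBesicovitchCovering.no_satelliteConfig (α := Fin n → ℝ)
  set M : ℝ≥0∞ := N * 2 ^ n + 1 with hM
  have hMtop : M ≠ ⊤ := by simp [hM, ENNReal.mul_eq_top]
  obtain ⟨ε₀, hε₀, hsmall⟩ := h (2⁻¹ / M) (ENNReal.div_pos (by simp) hMtop).ne'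
  have hNθ : (N : ℝ≥0∞) * (2 ^ n * (2⁻¹ / M)) ≤ 2⁻¹ := by
    calc (N : ℝ≥0∞) * (2 ^ n * (2⁻¹ / M)) ≤ M * (2⁻¹ / M) := by
          rw [← mul_assoc]
          gcongr
          exact le_self_add
      _ = 2⁻¹ := ENNReal.mul_div_cancel (by simp [hM]) hMtop
  obtain ⟨ε, hε0, hε1, hεε₀⟩ : ∃ ε : ℝ, 0 < ε ∧ ε < 1 ∧
      ENNReal.ofReal ε * ENNReal.ofReal (c * 4 ^ d) < ε₀ := by
    have hlim : Tendsto (fun ε : ℝ => ENNReal.ofReal ε * ENNReal.ofReal (c * 4 ^ d)) (𝓝[>] 0)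
        (𝓝 0) := by
      have : Tendsto (fun ε : ℝ => ENNReal.ofReal ε) (𝓝[>] 0) (𝓝 0) := by
        simpa using (ENNReal.continuous_ofReal.tendsto 0).mono_left nhdsWithin_le_nhds
      simpa using ENNReal.Tendsto.mul_const this (Or.inr ENNReal.ofReal_ne_top)
    obtain ⟨ε, hε, hε'⟩ := ((hlim.eventually (gt_mem_nhds (pos_iff_ne_zero.2 hε₀))).and
      (Ioo_mem_nhdsGT one_pos)).exists
    exact ⟨ε, hε'.1, hε'.2, hε⟩
  have hN1 : (0 : ℝ) < N + 1 := by positivity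
  refine ⟨ε / (N + 1), by positivity, ?_, ?_⟩
  · exact (div_le_self hε0.le (by simp)).trans_lt hε1
  set a : ℝ≥0∞ := ENNReal.ofReal (ε / (N + 1)) with ha
  have haε : a ≤ ENNReal.ofReal ε := ENNReal.ofReal_le_ofReal (div_le_self hε0.le (by simp))
  have haN : a * (N + 1) = ENNReal.ofReal ε := by
    rw [ha, show (N + 1 : ℝ≥0∞) = ENNReal.ofReal (N + 1) by
      rw [ENNReal.ofReal_add (by positivity) zero_le_one]; simp,
      ← ENNReal.ofReal_mul (by positivity), div_mul_cancel₀ _ hN1.ne']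
  have ha0 : a ≠ 0 := by
    rw [ha, Ne, ENNReal.ofReal_eq_zero, not_le]
    positivity
  have hatop : a ≠ ⊤ := ENNReal.ofReal_ne_top
  intro k
  induction k with
  | zero =>
    intro Q E _ hEQ _
    simpa using measure_mono hEQ
  | succ k ih =>
    intro Q E hEm hEQ hE
    have ha1 : a ≤ 1 := haε.trans (ENNReal.ofReal_le_one.2 hε1.le)
    have hEε : μ E ≤ ENNReal.ofReal ε * μ Q.carrier := by
      refine hE.trans ?_
      gcongr
      rw [pow_succ]
      exact (mul_le_of_le_one_left' (pow_le_one' ha1 k)).trans haε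
    obtain ⟨F, hFm, hFQ, hμF, hνF⟩ := hμ.exists_enlargement hνμ hτ hN hsmall hεε₀
      (ENNReal.ofReal_lt_one.2 hε1) Q hEm hEQ hEε
    have hF : μ F ≤ a ^ k * μ Q.carrier := by
      have hN1' : ((N : ℝ≥0∞) + 1) ≠ 0 := by simp
      have hN1top : ((N : ℝ≥0∞) + 1) ≠ ⊤ := by simp
      have key : ((N : ℝ≥0∞) + 1) * (a * μ F) ≤ (N + 1) * (a * (a ^ k * μ Q.carrier)) := by
        calc ((N : ℝ≥0∞) + 1) * (a * μ F) = ENNReal.ofReal ε * μ F := by rw [← haN]; ring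
          _ ≤ N * μ E := hμF
          _ ≤ (N + 1) * (a ^ (k + 1) * μ Q.carrier) := by
              gcongr
              exact le_self_add
          _ = (N + 1) * (a * (a ^ k * μ Q.carrier)) := by ring
      rwa [ENNReal.mul_le_mul_iff_right hN1' hN1top, ENNReal.mul_le_mul_iff_right ha0 hatop] at key
    calc ν E ≤ 2⁻¹ * (2⁻¹ ^ k * ν Q.carrier) := by
          refine hνF.trans ?_
          gcongr
          exact ih Q F hFm hFQ hF
      _ = 2⁻¹ ^ (k + 1) * ν Q.carrier := by ring

end Covering

/-- Geometric decay along a geometric scale gives a power bound. -/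
lemma exists_rpow_bound_of_geometric {a : ℝ} (ha0 : 0 < a) (ha1 : a < 1) :
    ∃ δ : ℝ, 0 < δ ∧ ∀ s t : ℝ, 0 ≤ t → t ≤ 1 → (∀ k : ℕ, t ≤ a ^ k → s ≤ (1 / 2) ^ k) →
      s ≤ 2 * t ^ δ := by
  have hδ : 0 < Real.logb a (1 / 2) :=
    Real.logb_pos_of_base_lt_one ha0 ha1 (by norm_num) (by norm_num)
  have haδ : a ^ Real.logb a (1 / 2) = 1 / 2 := Real.rpow_logb ha0 ha1.ne (by norm_num)
  refine ⟨Real.logb a (1 / 2), hδ, fun s t ht0 ht1 h => ?_⟩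
  rcases ht0.eq_or_lt with rfl | ht0
  · rw [Real.zero_rpow hδ.ne', mul_zero]
    exact ge_of_tendsto' (tendsto_pow_atTop_nhds_zero_of_lt_one (by norm_num) (by norm_num))
      fun k => h k (pow_nonneg ha0.le k)
  · obtain ⟨k, hk, hk'⟩ := exists_nat_pow_near_of_lt_one ht0 ht1 ha0 ha1
    calc s ≤ (1 / 2) ^ k := h k hk'
      _ = 2 * (a ^ Real.logb a (1 / 2)) ^ (k + 1) := by
          rw [haδ]
          ring
      _ = 2 * (a ^ (k + 1)) ^ Real.logb a (1 / 2) := by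
          rw [Real.rpow_pow_comm ha0.le]
      _ ≤ 2 * t ^ Real.logb a (1 / 2) := by
          gcongr

/-- Corollary 4.1: if a weight `w` satisfies, for some `C > 0` and some increasing
bijection `Φ : [0,1] → [0,1]` (with inverse `Φinv`), the smallness condition
`w(⋃_j Q_j)/w(Q) ≤ C Φ⁻¹(μ(⋃_j Q_j)/μ(Q))` for every cube `Q` and every countable
pairwise-disjoint family of subcubes of `Q`, then `w ∈ A_∞(dμ)`. -/
theorem statement5 {n : ℕ} (μ : Measure (Fin n → ℝ)) (c d : ℝ) (hμ : IsDoubling μ c d)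
    (w : (Fin n → ℝ) → ℝ) (hw0 : ∀ x, 0 ≤ w x) (hwloc : LocallyIntegrable w μ)
    (hwpos : ∀ Q : Cube n, 0 < ∫ x in Q.carrier, w x ∂μ)
    (C : ℝ) (hC : 0 < C) (Φ Φinv : ℝ → ℝ)
    (hmono : StrictMonoOn Φ (Set.Icc 0 1))
    (hbij : Set.BijOn Φ (Set.Icc 0 1) (Set.Icc 0 1))
    (hinv : ∀ t ∈ Set.Icc (0 : ℝ) 1, Φinv t ∈ Set.Icc (0 : ℝ) 1 ∧ Φ (Φinv t) = t)
    (hyp : ∀ (Q : Cube n) (J : Set ℕ) (Qj : ℕ → Cube n),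
      (∀ j ∈ J, (Qj j).carrier ⊆ Q.carrier) →
      (J.Pairwise fun i j => Disjoint (Qj i).carrier (Qj j).carrier) →
      (∫ x in ⋃ j ∈ J, (Qj j).carrier, w x ∂μ) / (∫ x in Q.carrier, w x ∂μ) ≤
        C * Φinv ((μ (⋃ j ∈ J, (Qj j).carrier)).toReal / (μ Q.carrier).toReal)) :
    ∃ δ C' : ℝ, 0 < δ ∧ 0 < C' ∧
      ∀ (Q : Cube n) (E : Set (Fin n → ℝ)), MeasurableSet E → E ⊆ Q.carrier →
        (∫ x in E, w x ∂μ) / (∫ x in Q.carrier, w x ∂μ) ≤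
          C' * ((μ E).toReal / (μ Q.carrier).toReal) ^ δ := by
  have := hμ.isLocallyFiniteMeasure
  set ν : Measure (Fin n → ℝ) := μ.withDensity fun x => ENNReal.ofReal (w x) with hν
  have hνμ : ν ≪ μ := withDensity_absolutelyContinuous _ _
  have hνE : ∀ (Q : Cube n) (E : Set (Fin n → ℝ)), MeasurableSet E → E ⊆ Q.carrier →
      ν E = ENNReal.ofReal (∫ x in E, w x ∂μ) := by
    intro Q E hE hEQ
    rw [hν, withDensity_apply _ hE, ofReal_integral_eq_lintegral_ofReal
      ((hwloc.integrableOn_isCompact Q.isCompact_carrier).mono_set hEQ)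
      (Eventually.of_forall hw0)]
  have hμpos : ∀ Q : Cube n, 0 < (μ Q.carrier).toReal := fun Q =>
    ENNReal.toReal_pos (hμ.2.2.1 Q).1.ne' (hμ.2.2.1 Q).2.ne
  have hratio : ∀ (Q : Cube n) (E : Set (Fin n → ℝ)), E ⊆ Q.carrier → ∀ ρ : ℝ, 0 ≤ ρ →
      ((μ E).toReal / (μ Q.carrier).toReal ≤ ρ ↔ μ E ≤ ENNReal.ofReal ρ * μ Q.carrier) := by
    intro Q E hEQ ρ hρ
    have hE : μ E ≠ ⊤ := ((measure_mono hEQ).trans_lt (hμ.2.2.1 Q).2).ne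
    rw [div_le_iff₀ (hμpos Q), ← ENNReal.le_ofReal_iff_toReal_le hE
      (mul_nonneg hρ (hμpos Q).le), ENNReal.ofReal_mul hρ,
      ENNReal.ofReal_toReal (hμ.2.2.1 Q).2.ne]
  have hsmall : ∀ θ : ℝ≥0∞, θ ≠ 0 → ∃ ε₀ : ℝ≥0∞, ε₀ ≠ 0 ∧ ∀ (Q : Cube n)
      (E : Set (Fin n → ℝ)), E ⊆ Q.carrier → μ E < ε₀ * μ Q.carrier →
      ν E ≤ θ * ν Q.carrier := by
    intro θ hθ
    obtain ⟨η, hη0, hηθ⟩ := ENNReal.lt_iff_exists_nnreal_btwn.1 (pos_iff_ne_zero.2 hθ)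
    have hη0' : (0 : ℝ) < η := by exact_mod_cast hη0
    set s : ℝ := min (η / C) 1 with hs
    have hs0 : 0 < s := lt_min (div_pos hη0' hC) one_pos
    have hsI : s ∈ Icc (0 : ℝ) 1 := ⟨hs0.le, min_le_right _ _⟩
    have hΦs : 0 < Φ s :=
      (hbij.mapsTo (left_mem_Icc.2 zero_le_one)).1.trans_lt
        (hmono (left_mem_Icc.2 zero_le_one) hsI hs0)
    refine ⟨ENNReal.ofReal (Φ s), by simpa using hΦs, fun Q E hEQ hE => ?_⟩
    refine hμ.small_of_small_iUnion hνμ (fun Q J Qj hsub hdisj hU => ?_) Q hEQ hE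
    have hUQ : ⋃ j ∈ J, (Qj j).carrier ⊆ Q.carrier := iUnion₂_subset hsub
    have hUm : MeasurableSet (⋃ j ∈ J, (Qj j).carrier) :=
      MeasurableSet.biUnion (to_countable J) fun j _ => (Qj j).measurableSet_carrier
    rw [← hratio Q _ hUQ _ hΦs.le] at hU
    have ht := hinv _ ⟨by positivity, hU.trans (hbij.mapsTo hsI).2⟩
    have hts : Φinv ((μ (⋃ j ∈ J, (Qj j).carrier)).toReal / (μ Q.carrier).toReal) ≤ s := by
      rw [← hmono.le_iff_le ht.1 hsI, ht.2]
      exact hU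
    have hint : (∫ x in ⋃ j ∈ J, (Qj j).carrier, w x ∂μ) / (∫ x in Q.carrier, w x ∂μ) ≤ η := by
      calc _ ≤ C * _ := hyp Q J Qj hsub hdisj
        _ ≤ C * (η / C) := by
            gcongr
            exact hts.trans (min_le_left _ _)
        _ = η := mul_div_cancel₀ _ hC.ne'
    rw [div_le_iff₀ (hwpos Q)] at hint
    rw [hνE Q _ hUm hUQ, hνE Q _ Q.measurableSet_carrier subset_rfl]
    calc ENNReal.ofReal (∫ x in ⋃ j ∈ J, (Qj j).carrier, w x ∂μ)
        ≤ ENNReal.ofReal (η * ∫ x in Q.carrier, w x ∂μ) := ENNReal.ofReal_le_ofReal hint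
      _ = η * ENNReal.ofReal (∫ x in Q.carrier, w x ∂μ) := by
          rw [ENNReal.ofReal_mul η.coe_nonneg, ENNReal.ofReal_coe_nnreal]
      _ ≤ θ * ENNReal.ofReal (∫ x in Q.carrier, w x ∂μ) := by gcongr
  obtain ⟨a, ha0, ha1, hdecay⟩ := hμ.exists_geometric_decay hνμ hsmall
  obtain ⟨δ, hδ, hpow⟩ := exists_rpow_bound_of_geometric ha0 ha1
  refine ⟨δ, 2, hδ, two_pos, fun Q E hE hEQ => hpow _ _ (by positivity) ?_ fun k hk => ?_⟩
  · rw [hratio Q E hEQ 1 zero_le_one, ENNReal.ofReal_one, one_mul]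
    exact measure_mono hEQ
  · rw [hratio Q E hEQ _ (pow_nonneg ha0.le k), ENNReal.ofReal_pow ha0.le] at hk
    have := hdecay k Q E hE hEQ hk
    rw [hνE Q E hE hEQ, hνE Q _ Q.measurableSet_carrier subset_rfl] at this
    rw [div_le_iff₀ (hwpos Q), ← ENNReal.ofReal_le_ofReal_iff
      (mul_nonneg (by positivity) (hwpos Q).le), ENNReal.ofReal_mul (by positivity),
      ENNReal.ofReal_pow (by norm_num)]
    simpa [ENNReal.ofReal_inv_of_pos] using this

end
end

section
/- Let μ be a doubling measure on ℝⁿ with doubling constant c_μ which is not identically zero. Then for every cube Q in ℝⁿ there exist a subcube Q̃ ⊆ Q and a number α ∈ (0,1) such that μ(Q̃) = α μ(Q) and min{α, 1 − α} ≥ 1/(4 c_μ). -/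
open MeasureTheory Set Filter
open scoped ENNReal

noncomputable section

theorem Cube.carrier_eq_Icc {n : ℕ} (Q : Cube n) :
    Q.carrier = Icc Q.corner (fun i => Q.corner i + Q.side) := by
  ext x
  simp [Cube.carrier, Pi.le_def, forall_and]

theorem Cube.measurableSet_carrier_s9 {n : ℕ} (Q : Cube n) : MeasurableSet Q.carrier :=
  Q.carrier_eq_Icc ▸ measurableSet_Icc

/-- The point of the main diagonal of `Q` with parameter `θ`. -/
def Cube.diag {n : ℕ} (Q : Cube n) (θ : ℝ) : Fin n → ℝ :=
  fun i => Q.corner i + θ * Q.side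

/-- The image of `Q` under the homothety with centre `Q.diag θ` and ratio `t`. -/
def Cube.shrink {n : ℕ} (Q : Cube n) (θ t : ℝ) (ht : 0 < t) : Cube n where
  corner := fun i => Q.corner i + θ * (1 - t) * Q.side
  side := t * Q.side
  side_pos := mul_pos ht Q.side_pos

theorem Cube.shrink_carrier_mono {n : ℕ} (Q : Cube n) {θ s t : ℝ} (hθ0 : 0 ≤ θ) (hθ1 : θ ≤ 1)
    (hs : 0 < s) (ht : 0 < t) (hst : s ≤ t) :
    (Q.shrink θ s hs).carrier ⊆ (Q.shrink θ t ht).carrier := by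
  intro x hx i
  have h := hx i
  have h1 : 0 ≤ θ * ((t - s) * Q.side) :=
    mul_nonneg hθ0 (mul_nonneg (sub_nonneg.2 hst) Q.side_pos.le)
  have h2 : 0 ≤ (1 - θ) * ((t - s) * Q.side) :=
    mul_nonneg (sub_nonneg.2 hθ1) (mul_nonneg (sub_nonneg.2 hst) Q.side_pos.le)
  simp only [Cube.shrink] at h ⊢
  constructor <;> linarith [h.1, h.2]

theorem Cube.diag_mem_carrier {n : ℕ} (Q : Cube n) {θ : ℝ} (hθ0 : 0 ≤ θ) (hθ1 : θ ≤ 1) :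
    Q.diag θ ∈ Q.carrier := by
  intro i
  have := Q.side_pos
  simp only [Cube.diag]
  constructor <;> nlinarith

theorem Cube.diag_injective {n : ℕ} [NeZero n] (Q : Cube n) : Function.Injective Q.diag := by
  intro a b hab
  have := congrFun hab 0
  simpa [Cube.diag, Q.side_pos.ne'] using this

/-- A nontrivial finite measure on a cube has small mass at some point of the diagonal. -/
theorem Cube.exists_measure_singleton_lt_half {n : ℕ} [NeZero n] (Q : Cube n)
    (μ : Measure (Fin n → ℝ)) (hQ : 0 < μ Q.carrier ∧ μ Q.carrier < ⊤) :
    ∃ θ : ℝ, 0 ≤ θ ∧ θ ≤ 1 ∧ μ {Q.diag θ} < μ Q.carrier / 2 := by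
  by_contra! h
  have hfin := Measure.finite_const_le_meas_of_disjoint_iUnion (μ.restrict Q.carrier)
    (ε := μ Q.carrier / 2) (ENNReal.half_pos hQ.1.ne')
    (As := fun θ : Icc (0 : ℝ) 1 => {Q.diag θ}) (fun _ => measurableSet_singleton _)
    (fun a b hab => by
      simpa using fun e : Q.diag a = Q.diag b => hab (Subtype.ext (Q.diag_injective e)))
    ((measure_mono (subset_univ _)).trans_lt (by simpa using hQ.2)).ne
  have huniv : {θ : Icc (0 : ℝ) 1 |
      μ Q.carrier / 2 ≤ μ.restrict Q.carrier {Q.diag θ}} = univ := by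
    refine eq_univ_of_forall fun θ => ?_
    have hsub : ({Q.diag θ} : Set (Fin n → ℝ)) ⊆ Q.carrier :=
      singleton_subset_iff.2 (Q.diag_mem_carrier θ.2.1 θ.2.2)
    simpa only [mem_ofPred_eq, Measure.restrict_eq_self μ hsub] using h θ θ.2.1 θ.2.2
  rw [huniv] at hfin
  have : Infinite (Icc (0 : ℝ) 1) := (Icc_infinite zero_lt_one).to_subtype
  exact infinite_univ hfin

theorem Cube.tendsto_measure_shrink {n : ℕ} (Q : Cube n) (μ : Measure (Fin n → ℝ))
    (hQ : μ Q.carrier < ⊤) {θ : ℝ} (hθ0 : 0 ≤ θ) (hθ1 : θ ≤ 1) {t : ℕ → ℝ}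
    (ht : ∀ k, 0 < t k) (hanti : Antitone t) (ht0 : t 0 ≤ 1)
    (hlim : Tendsto t atTop (nhds 0)) :
    Tendsto (fun k => μ (Q.shrink θ (t k) (ht k)).carrier) atTop (nhds (μ {Q.diag θ})) := by
  have hone : (Q.shrink θ 1 one_pos).carrier = Q.carrier := by simp [Cube.shrink, Cube.carrier]
  have hinter : ⋂ k, (Q.shrink θ (t k) (ht k)).carrier = {Q.diag θ} := by
    refine Subset.antisymm (fun x hx => ?_) (singleton_subset_iff.2 (mem_iInter.2 fun k => ?_))
    · ext i
      have hx' := fun k => mem_iInter.1 hx k i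
      have hl : Tendsto (fun k => Q.corner i + θ * (1 - t k) * Q.side) atTop
          (nhds (Q.corner i + θ * (1 - 0) * Q.side)) :=
        (((hlim.const_sub 1).const_mul θ).mul_const Q.side).const_add _
      have hu := hl.add (hlim.mul_const Q.side)
      have h1 := le_of_tendsto' hl fun k => (hx' k).1
      have h2 := ge_of_tendsto' hu fun k => (hx' k).2
      simp only [Cube.diag]
      linarith
    · convert (Q.shrink θ (t k) (ht k)).diag_mem_carrier hθ0 hθ1 using 1
      ext i
      simp only [Cube.diag, Cube.shrink]
      ring
  rw [← hinter]
  refine tendsto_measure_iInter_atTop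
    (fun k => (Cube.measurableSet_carrier_s9 _).nullMeasurableSet)
    (fun a b hab => Q.shrink_carrier_mono hθ0 hθ1 _ _ (hanti hab)) ⟨0, ?_⟩
  exact ((measure_mono (hone ▸ Q.shrink_carrier_mono hθ0 hθ1 (ht 0) one_pos ht0)).trans_lt hQ).ne

/-- There is no doubling measure in dimension zero, as all cubes there coincide. -/
theorem not_isDoubling_zero (μ : Measure (Fin 0 → ℝ)) (c d : ℝ) : ¬ IsDoubling μ c d := by
  rintro ⟨hc, hd, hpos, hdbl⟩
  have hc0 : 0 < c := by linarith
  have ht : 0 < (1 / (2 * c)) ^ (1 / d) := by positivity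
  let A : Cube 0 := ⟨0, 1, one_pos⟩
  let B : Cube 0 := ⟨0, (1 / (2 * c)) ^ (1 / d), ht⟩
  have hAB : B.carrier = A.carrier := by simp [A, B, Cube.carrier]
  have h := hdbl A B hAB.symm.subset
  have hfactor : c * (B.side / A.side) ^ d = 1 / 2 := by
    simp only [A, B, div_one]
    rw [← Real.rpow_mul (by positivity), one_div_mul_cancel hd.ne', Real.rpow_one]
    field_simp
  rw [hfactor, hAB] at h
  have h' := ENNReal.toReal_mono
    (ENNReal.mul_ne_top ENNReal.ofReal_ne_top (hpos A).2.ne) h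
  rw [ENNReal.toReal_mul, ENNReal.toReal_ofReal (by norm_num)] at h'
  linarith [ENNReal.toReal_pos (hpos A).1.ne' (hpos A).2.ne]

/-- Lemma A.2: if `μ` is a nontrivial doubling measure on `ℝⁿ` with doubling constant
`c`, then every cube `Q` has a subcube `Q̃` with `μ(Q̃) = α μ(Q)` for some `α ∈ (0,1)`
with `min{α, 1 − α} ≥ 1/(4c)`. -/
theorem statement9 {n : ℕ} (μ : Measure (Fin n → ℝ)) (c d : ℝ) (hμ : IsDoubling μ c d)
    (hne : μ ≠ 0) (Q : Cube n) :
    ∃ (Q' : Cube n) (α : ℝ), Q'.carrier ⊆ Q.carrier ∧ 0 < α ∧ α < 1 ∧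
      μ Q'.carrier = ENNReal.ofReal α * μ Q.carrier ∧
      1 / (4 * c) ≤ min α (1 - α) := by
  obtain rfl | hn := Nat.eq_zero_or_pos n
  · exact absurd hμ (not_isDoubling_zero μ c d)
  have : NeZero n := ⟨hn.ne'⟩
  obtain ⟨hc, hd, hpos, hdbl⟩ := hμ
  obtain ⟨θ, hθ0, hθ1, hθ⟩ := Q.exists_measure_singleton_lt_half μ (hpos Q)
  set r : ℝ := (1 / 2 : ℝ) ^ (1 / d) with hr
  have hr0 : 0 < r := by positivity
  have hr1 : r < 1 := Real.rpow_lt_one (by norm_num) (by norm_num) (by positivity)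
  have hrd : (1 / r) ^ d = 2 := by
    rw [Real.div_rpow zero_le_one hr0.le, Real.one_rpow, hr, ← Real.rpow_mul (by norm_num),
      one_div_mul_cancel hd.ne', Real.rpow_one]
    norm_num
  have hk0 (k : ℕ) : 0 < r ^ k := by positivity
  have hkanti : Antitone fun k : ℕ => r ^ k := pow_right_anti₀ hr0.le hr1.le
  let S (k : ℕ) : Cube n := Q.shrink θ (r ^ k) (hk0 k)
  have hex : ∃ k, μ (S k).carrier < μ Q.carrier / 2 :=
    (((Q.tendsto_measure_shrink μ (hpos Q).2 hθ0 hθ1 hk0 hkanti (by simp)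
      (tendsto_pow_atTop_nhds_zero_of_lt_one hr0.le hr1)).eventually
        (gt_mem_nhds hθ))).exists
  have hS0 : (S 0).carrier = Q.carrier := by
    simp [S, Cube.shrink, Cube.carrier]
  obtain ⟨k, hk, hmin⟩ : ∃ k, μ (S (k + 1)).carrier < μ Q.carrier / 2 ∧
      μ Q.carrier / 2 ≤ μ (S k).carrier := by
    classical
    obtain ⟨k, hk⟩ : ∃ k, Nat.find hex = k + 1 := Nat.exists_eq_succ_of_ne_zero fun h => by
      have := (Nat.find_eq_zero hex).1 h
      rw [hS0] at this
      exact this.not_ge ENNReal.half_le_self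
    exact ⟨k, hk ▸ Nat.find_spec hex, not_lt.1 (Nat.find_min hex (by omega))⟩
  have hstep : μ (S k).carrier ≤ ENNReal.ofReal (c * 2) * μ (S (k + 1)).carrier := by
    have h := hdbl (S (k + 1)) (S k) (Q.shrink_carrier_mono hθ0 hθ1 _ _ (hkanti k.le_succ))
    have hq : (S k).side / (S (k + 1)).side = 1 / r := by
      have := Q.side_pos
      simp only [S, Cube.shrink]
      field_simp
      ring
    rwa [hq, hrd] at h
  have hsub : (S (k + 1)).carrier ⊆ Q.carrier :=
    hS0 ▸ Q.shrink_carrier_mono hθ0 hθ1 _ _ (hkanti (Nat.zero_le _))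
  have hQ : 0 < μ.real Q.carrier := ENNReal.toReal_pos (hpos Q).1.ne' (hpos Q).2.ne
  have hS : 0 < μ.real (S (k + 1)).carrier :=
    ENNReal.toReal_pos (hpos _).1.ne' (hpos _).2.ne
  have hlt : μ.real (S (k + 1)).carrier < μ.real Q.carrier / 2 := by
    have := (ENNReal.toReal_lt_toReal (hpos _).2.ne
      (ENNReal.div_ne_top (hpos Q).2.ne two_ne_zero)).2 hk
    simpa [Measure.real] using this
  have hle : μ.real Q.carrier / 2 ≤ c * 2 * μ.real (S (k + 1)).carrier := by
    have := ENNReal.toReal_mono (ENNReal.mul_ne_top ENNReal.ofReal_ne_top (hpos _).2.ne)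
      (hmin.trans hstep)
    rw [ENNReal.toReal_mul, ENNReal.toReal_ofReal (by positivity)] at this
    simpa [Measure.real] using this
  have hhalf : μ.real (S (k + 1)).carrier / μ.real Q.carrier < 1 / 2 := by
    rw [div_lt_iff₀ hQ]
    linarith
  refine ⟨S (k + 1), μ.real (S (k + 1)).carrier / μ.real Q.carrier, hsub, by positivity,
    by linarith, ?_, le_min ?_ ?_⟩
  · rw [ENNReal.ofReal_div_of_pos hQ, ofReal_measureReal (hpos _).2.ne,
      ofReal_measureReal (hpos Q).2.ne, ENNReal.div_mul_cancel (hpos Q).1.ne' (hpos Q).2.ne]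
  · rw [div_le_div_iff₀ (by positivity) hQ]
    linarith
  · have : 1 / (4 * c) ≤ 1 / 4 := one_div_le_one_div_of_le (by norm_num) (by linarith)
    linarith

end
end
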